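/- Let A ∈ SM(n, ℂ) be invertible and let P ∈ ℂ[z_1, …, z_n] be a homogeneous Δ_A-nilpotent polynomial of degree d ≥ 3. Then for every m ≥ 0 the polynomial Δ_A^m P^{m+1} is isotropic with respect to the bilinear form (·,·)_A, i.e., (Δ_A^m P^{m+1}, Δ_A^m P^{m+1})_A = 0. In particular, (P, P)_A = 0. -/

import Mathlib

open MvPolynomial

noncomputable def Delta {n : ℕ} (A : Matrix (Fin n) (Fin n) ℂ) :
    Module.End ℂ (MvPolynomial (Fin n) ℂ) :=
  ∑ i, ∑ j, A i j • ((pderiv i).toLinearMap ∘ₗ (pderiv j).toLinearMap)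

/-- `P` is `Λ`-nilpotent: `Λ^m(P^m) = 0` for all `m ≥ 1`. -/
def LNil {n : ℕ} (Λ : Module.End ℂ (MvPolynomial (Fin n) ℂ))
    (P : MvPolynomial (Fin n) ℂ) : Prop :=
  ∀ m : ℕ, 1 ≤ m → (Λ ^ m) (P ^ m) = 0

/-- The `i`-th entry of the vector of operators `AD`, i.e. `Σⱼ aᵢⱼ Dⱼ`. -/
noncomputable def LD {n : ℕ} (A : Matrix (Fin n) (Fin n) ℂ) (i : Fin n) :
    Module.End ℂ (MvPolynomial (Fin n) ℂ) :=
  ∑ j, A i j • (pderiv j).toLinearMap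

/-- The constant-coefficient differential operator `f(AD)`, obtained by substituting
`Σⱼ aᵢⱼ Dⱼ` for `zᵢ` in `f`. -/
noncomputable def opOf {n : ℕ} (A : Matrix (Fin n) (Fin n) ℂ)
    (f : MvPolynomial (Fin n) ℂ) : Module.End ℂ (MvPolynomial (Fin n) ℂ) :=
  ∑ d ∈ f.support, MvPolynomial.coeff d f • (List.ofFn fun i => (LD A i) ^ (d i)).prod

/-- The symmetric bilinear form `(f, g)_A = (f(AD)g)|_{z=0}` on `ℂ[z]`. -/
noncomputable def bform {n : ℕ} (A : Matrix (Fin n) (Fin n) ℂ)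
    (f g : MvPolynomial (Fin n) ℂ) : ℂ :=
  constantCoeff ((opOf A f) g)

open Finset

/-- The second-order operator `Σ aᵢⱼ δᵢ δⱼ` attached to a family of derivations `δ`. -/
noncomputable def derivLaplacian {S : Type*} [CommRing S] [Algebra ℂ S] {n : ℕ}
    (A : Matrix (Fin n) (Fin n) ℂ) (δ : Fin n → Derivation ℂ S S) (F : S) : S :=
  ∑ i, ∑ j, A i j • δ i (δ j F)

theorem derivLaplacian_pow_add_two {S : Type*} [CommRing S] [Algebra ℂ S] {n : ℕ}
    (A : Matrix (Fin n) (Fin n) ℂ) (δ : Fin n → Derivation ℂ S S) (F : S) (m : ℕ) :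
    derivLaplacian A δ (F ^ (m + 2)) = (m + 2) * F ^ (m + 1) * derivLaplacian A δ F +
      (m + 2) * (m + 1) * F ^ m * ∑ i, ∑ j, A i j • (δ i F * δ j F) := by
  have key (i j : Fin n) : δ i (δ j (F ^ (m + 2))) =
      (m + 2) * F ^ (m + 1) * δ i (δ j F) + (m + 2) * (m + 1) * F ^ m * (δ i F * δ j F) := by
    rw [Derivation.leibniz_pow, map_nsmul, show m + 2 - 1 = m + 1 from rfl]
    simp only [Derivation.leibniz_pow, Derivation.leibniz, smul_eq_mul,
      Nat.add_sub_cancel, nsmul_eq_mul]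
    push_cast
    ring
  simp only [derivLaplacian, key, mul_sum, ← sum_add_distrib]
  refine sum_congr rfl fun i _ => sum_congr rfl fun j _ => ?_
  rw [smul_add, mul_smul_comm, mul_smul_comm]

theorem two_mul_derivLaplacian_pow {S : Type*} [CommRing S] [Algebra ℂ S] {n : ℕ}
    (A : Matrix (Fin n) (Fin n) ℂ) (δ : Fin n → Derivation ℂ S S) {F : S}
    (hF : derivLaplacian A δ F = 0) (m : ℕ) :
    2 * derivLaplacian A δ (F ^ (m + 2)) =
      (m + 2) * (m + 1) * F ^ m * derivLaplacian A δ (F ^ 2) := by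
  have h2 := derivLaplacian_pow_add_two A δ F 0
  rw [zero_add] at h2
  rw [h2, derivLaplacian_pow_add_two, hF]
  push_cast
  ring

/-- The derivation of `R⟦X⟧` acting on coefficients by a derivation of `R`. -/
noncomputable def powerSeriesCoeffDerivation {R : Type*} [CommRing R] [Algebra ℂ R]
    (D : Derivation ℂ R R) : Derivation ℂ (PowerSeries R) (PowerSeries R) :=
  Derivation.mk'
    { toFun := fun F => PowerSeries.mk fun k => D (PowerSeries.coeff k F)
      map_add' := fun F G => by ext k; simp
      map_smul' := fun c F => by
        ext k
        simp }
    (fun F G => by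
      ext k
      simp only [LinearMap.coe_mk, AddHom.coe_mk, PowerSeries.coeff_mk, PowerSeries.coeff_mul,
        map_sum, Derivation.leibniz, smul_eq_mul, map_add, sum_add_distrib]
      congr 1
      rw [← Nat.sum_antidiagonal_swap]
      rfl)

theorem coeff_powerSeriesCoeffDerivation {R : Type*} [CommRing R] [Algebra ℂ R]
    (D : Derivation ℂ R R) (k : ℕ) (F : PowerSeries R) :
    PowerSeries.coeff k (powerSeriesCoeffDerivation D F) = D (PowerSeries.coeff k F) := by
  simp [powerSeriesCoeffDerivation]

section Laplacian

variable {n : ℕ} (A : Matrix (Fin n) (Fin n) ℂ)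

theorem Delta_apply (f : MvPolynomial (Fin n) ℂ) :
    Delta A f = ∑ i, ∑ j, A i j • pderiv i (pderiv j f) := by
  simp [Delta, LinearMap.sum_apply]

theorem LD_apply (i : Fin n) (f : MvPolynomial (Fin n) ℂ) :
    LD A i f = ∑ j, A i j • pderiv j f := by
  simp [LD, LinearMap.sum_apply]

/-- `Δ_A` acting on the coefficients of a power series. -/
noncomputable def seriesLaplacian (F : PowerSeries (MvPolynomial (Fin n) ℂ)) :
    PowerSeries (MvPolynomial (Fin n) ℂ) :=
  derivLaplacian A (fun i => powerSeriesCoeffDerivation (pderiv i)) F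

theorem coeff_seriesLaplacian (k : ℕ) (F : PowerSeries (MvPolynomial (Fin n) ℂ)) :
    PowerSeries.coeff k (seriesLaplacian A F) = Delta A (PowerSeries.coeff k F) := by
  simp [seriesLaplacian, derivLaplacian, Delta_apply, coeff_powerSeriesCoeffDerivation]

/-- The normalising constants of the series `Σ Δ^k P^{k+1} t^k / (2^k k! (k+1)!)`. -/
noncomputable def inversionCoeff (k : ℕ) : ℂ :=
  (2 ^ k * k.factorial * (k + 1).factorial : ℂ)⁻¹

theorem inversionCoeff_ne_zero (k : ℕ) : inversionCoeff k ≠ 0 := by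
  have h1 : (k.factorial : ℂ) ≠ 0 := by exact_mod_cast k.factorial_ne_zero
  have h2 : ((k + 1).factorial : ℂ) ≠ 0 := by exact_mod_cast (k + 1).factorial_ne_zero
  simp [inversionCoeff, h1, h2]

/-- The series `Σ Δ^k P^{k+1} t^k / (2^k k! (k+1)!)`. -/
noncomputable def inversionSeries (P : MvPolynomial (Fin n) ℂ) :
    PowerSeries (MvPolynomial (Fin n) ℂ) :=
  PowerSeries.mk fun k => inversionCoeff k • (Delta A ^ k) (P ^ (k + 1))

theorem seriesLaplacian_inversionSeries {P : MvPolynomial (Fin n) ℂ} (hP : LNil (Delta A) P) :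
    seriesLaplacian A (inversionSeries A P) = 0 := by
  ext1 k
  rw [coeff_seriesLaplacian, inversionSeries, PowerSeries.coeff_mk, map_smul,
    ← Module.End.mul_apply, ← pow_succ', hP (k + 1) (by omega), smul_zero, map_zero]

theorem Delta_coeff_pow {P : MvPolynomial (Fin n) ℂ} (hP : LNil (Delta A) P) (k : ℕ)
    (hk : ∀ j < k, Delta A (PowerSeries.coeff j (inversionSeries A P ^ 2)) =
      (4 * (j + 1) : ℂ) • PowerSeries.coeff (j + 1) (inversionSeries A P))
    (m j : ℕ) (hj : j < k) :
    Delta A (PowerSeries.coeff j (inversionSeries A P ^ (m + 2))) =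
      (2 * (m + 2) * (j + 1) : ℂ) •
        PowerSeries.coeff (j + 1) (inversionSeries A P ^ (m + 1)) := by
  set F := inversionSeries A P with hF
  have h := two_mul_derivLaplacian_pow A (fun i => powerSeriesCoeffDerivation (pderiv i))
    (seriesLaplacian_inversionSeries A hP) m
  change 2 * seriesLaplacian A (F ^ (m + 2)) = (m + 2) * (m + 1) * F ^ m * seriesLaplacian A (F ^ 2) at h
  have hd : PowerSeries.X ^ k ∣ seriesLaplacian A (F ^ 2) -
      4 * PowerSeries.derivative (MvPolynomial (Fin n) ℂ) F := by
    rw [PowerSeries.X_pow_dvd_iff]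
    intro i hi
    have h4 : (4 : PowerSeries (MvPolynomial (Fin n) ℂ)) = PowerSeries.C 4 := (map_ofNat _ 4).symm
    rw [map_sub, coeff_seriesLaplacian, hk i hi, h4, PowerSeries.coeff_C_mul,
      PowerSeries.coeff_derivative, smul_eq_C_mul]
    simp only [map_mul, map_add, map_one, map_natCast, map_ofNat]
    ring
  obtain ⟨G, hG⟩ := hd
  have hder : PowerSeries.derivative (MvPolynomial (Fin n) ℂ) (F ^ (m + 1)) =
      (m + 1) * F ^ m * PowerSeries.derivative (MvPolynomial (Fin n) ℂ) F := by
    rw [Derivation.leibniz_pow]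
    simp [smul_eq_mul, nsmul_eq_mul, mul_assoc]
  have h' : PowerSeries.C (2 : MvPolynomial (Fin n) ℂ) * seriesLaplacian A (F ^ (m + 2)) =
      PowerSeries.C (4 * (m + 2) : MvPolynomial (Fin n) ℂ) *
        PowerSeries.derivative (MvPolynomial (Fin n) ℂ) (F ^ (m + 1)) +
      (PowerSeries.X : PowerSeries (MvPolynomial (Fin n) ℂ)) ^ k * ((m + 2) * (m + 1) * F ^ m * G) := by
    rw [hder]
    simp only [map_mul, map_add, map_natCast, map_ofNat]
    rw [h]
    linear_combination (m + 2) * (m + 1) * F ^ m * hG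
  have h'' := congrArg (PowerSeries.coeff j) h'
  rw [map_add, PowerSeries.coeff_C_mul, PowerSeries.coeff_C_mul, PowerSeries.coeff_X_pow_mul',
    if_neg (by omega), add_zero, PowerSeries.coeff_derivative, coeff_seriesLaplacian] at h''
  have h2 : (2 : MvPolynomial (Fin n) ℂ) ≠ 0 := two_ne_zero
  apply mul_left_cancel₀ h2
  rw [h'', smul_eq_C_mul]
  simp only [map_mul, map_add, map_one, map_natCast, map_ofNat]
  ring

theorem Delta_pow_eq_coeff_pow {P : MvPolynomial (Fin n) ℂ} (hP : LNil (Delta A) P) (k : ℕ)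
    (hk : ∀ j < k, Delta A (PowerSeries.coeff j (inversionSeries A P ^ 2)) =
      (4 * (j + 1) : ℂ) • PowerSeries.coeff (j + 1) (inversionSeries A P))
    (j m : ℕ) (hj : j + m = k) :
    ((m + 2).factorial : ℂ) • (Delta A ^ j) (P ^ (k + 2)) =
      (2 ^ j * j.factorial * (k + 2).factorial : ℂ) •
        PowerSeries.coeff j (inversionSeries A P ^ (m + 2)) := by
  induction j generalizing m with
  | zero =>
    obtain rfl : m = k := by omega
    have hc : PowerSeries.constantCoeff (inversionSeries A P) = P := by
      rw [← PowerSeries.coeff_zero_eq_constantCoeff_apply, inversionSeries, PowerSeries.coeff_mk]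
      simp [inversionCoeff]
    simp [hc]
  | succ j ih =>
    have h := congrArg (Delta A) (ih (m + 1) (by omega))
    rw [map_smul, map_smul, ← Module.End.mul_apply, ← pow_succ',
      Delta_coeff_pow A hP k hk (m + 1) j (by omega), smul_smul] at h
    have h3 : ((m + 3 : ℕ) : ℂ) ≠ 0 := by exact_mod_cast (by omega : m + 3 ≠ 0)
    apply smul_right_injective _ h3
    simp only [smul_smul]
    convert h using 2
    · rw [show m + 1 + 2 = (m + 2) + 1 by ring, Nat.factorial_succ (m + 2)]
      push_cast
      ring
    · rw [Nat.factorial_succ j]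
      push_cast
      ring

theorem Delta_coeff_inversionSeries_sq {P : MvPolynomial (Fin n) ℂ} (hP : LNil (Delta A) P)
    (k : ℕ) : Delta A (PowerSeries.coeff k (inversionSeries A P ^ 2)) =
      (4 * (k + 1) : ℂ) • PowerSeries.coeff (k + 1) (inversionSeries A P) := by
  induction k using Nat.strong_induction_on with
  | _ k hk =>
    have h := congrArg (Delta A) (Delta_pow_eq_coeff_pow A hP k hk k 0 rfl)
    rw [map_smul, map_smul, ← Module.End.mul_apply, ← pow_succ'] at h
    have h1 : (k.factorial : ℂ) ≠ 0 := by exact_mod_cast k.factorial_ne_zero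
    have h2 : ((k + 2).factorial : ℂ) ≠ 0 := by exact_mod_cast (k + 2).factorial_ne_zero
    have h0 : (2 ^ k * k.factorial * (k + 2).factorial : ℂ) ≠ 0 := by
      simp [h1, h2]
    have h3 : (k + 1 : ℂ) ≠ 0 := by exact_mod_cast k.succ_ne_zero
    apply smul_right_injective _ h0
    simp only [zero_add] at h
    simp only
    rw [← h, inversionSeries, PowerSeries.coeff_mk, smul_smul, smul_smul]
    congr 1
    rw [inversionCoeff, Nat.factorial_succ k, show k + 1 + 1 = k + 2 by rfl]
    push_cast
    field_simp
    norm_num [Nat.factorial]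
    ring

theorem Delta_sq_coeff_inversionSeries_sq {P : MvPolynomial (Fin n) ℂ}
    (hP : LNil (Delta A) P) (k : ℕ) :
    (Delta A ^ 2) (PowerSeries.coeff k (inversionSeries A P ^ 2)) = 0 := by
  rw [pow_two, Module.End.mul_apply, Delta_coeff_inversionSeries_sq A hP, map_smul,
    ← coeff_seriesLaplacian, seriesLaplacian_inversionSeries A hP, map_zero, smul_zero]

theorem pderiv_comm (a b : Fin n) (f : MvPolynomial (Fin n) ℂ) :
    pderiv a (pderiv b f) = pderiv b (pderiv a f) := by
  have h : ∀ D E : Derivation ℂ (MvPolynomial (Fin n) ℂ) (MvPolynomial (Fin n) ℂ),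
      D = pderiv a → E = pderiv b → ⁅D, E⁆ = 0 := by
    rintro _ _ rfl rfl
    refine MvPolynomial.derivation_ext fun i => ?_
    simp [Derivation.commutator_apply, pderiv_X, Pi.single_apply, apply_ite]
  exact sub_eq_zero.1 (DFunLike.congr_fun (h _ _ rfl rfl) f)

theorem pderiv_Delta (i : Fin n) (f : MvPolynomial (Fin n) ℂ) :
    pderiv i (Delta A f) = Delta A (pderiv i f) := by
  simp only [Delta_apply, map_sum, Derivation.map_smul]
  refine sum_congr rfl fun a _ => sum_congr rfl fun b _ => ?_
  rw [pderiv_comm i a, pderiv_comm i b]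

variable {A} in
theorem Delta_mul_of_harmonic (hA : A.IsSymm) {f g : MvPolynomial (Fin n) ℂ}
    (hf : Delta A f = 0) (hg : Delta A g = 0) :
    Delta A (f * g) = (2 : ℂ) • ∑ i, ∑ j, A i j • (pderiv i f * pderiv j g) := by
  have h : Delta A (f * g) = f * Delta A g + g * Delta A f +
      (∑ i, ∑ j, A i j • (pderiv i f * pderiv j g) +
        ∑ i, ∑ j, A i j • (pderiv j f * pderiv i g)) := by
    simp only [Delta_apply, mul_sum, ← sum_add_distrib]
    refine sum_congr rfl fun i _ => sum_congr rfl fun j _ => ?_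
    simp only [Derivation.leibniz, map_add, smul_eq_mul, smul_eq_C_mul]
    ring
  have hs : ∑ i, ∑ j, A i j • (pderiv j f * pderiv i g) =
      ∑ i, ∑ j, A i j • (pderiv i f * pderiv j g) := by
    rw [sum_comm]
    exact sum_congr rfl fun i _ => sum_congr rfl fun j _ => by rw [hA.apply]
  rw [h, hf, hg, hs, two_smul]
  simp

variable {A} in
theorem Delta_pow_succ_mul_of_harmonic (hA : A.IsSymm) {f g : MvPolynomial (Fin n) ℂ}
    (hf : Delta A f = 0) (hg : Delta A g = 0) (N : ℕ) :
    (Delta A ^ (N + 1)) (f * g) =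
      (2 : ℂ) • ∑ i, ∑ j, A i j • (Delta A ^ N) (pderiv i f * pderiv j g) := by
  rw [pow_succ, Module.End.mul_apply, Delta_mul_of_harmonic hA hf hg]
  simp only [map_smul, map_sum]

variable {A} in
theorem Delta_pow_mul_eq_zero (hA : A.IsSymm) {N a : ℕ} (ha : a < N)
    {f g : MvPolynomial (Fin n) ℂ} (hf : Delta A f = 0) (hg : Delta A g = 0)
    (hfa : f.IsHomogeneous a) : (Delta A ^ N) (f * g) = 0 := by
  induction N generalizing a f g with
  | zero => omega
  | succ N ih =>
    rw [Delta_pow_succ_mul_of_harmonic hA hf hg]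
    have h (i j : Fin n) : (Delta A ^ N) (pderiv i f * pderiv j g) = 0 := by
      rcases a with _ | a
      · rw [((totalDegree_zero_iff_isHomogeneous _).2 hfa |> totalDegree_eq_zero_iff_eq_C.1),
          pderiv_C, zero_mul, map_zero]
      · exact ih (by omega : a < N) (by rw [← pderiv_Delta, hf, map_zero])
          (by rw [← pderiv_Delta, hg, map_zero]) hfa.pderiv
    simp [h]

theorem isHomogeneous_Delta {f : MvPolynomial (Fin n) ℂ} {a : ℕ} (hf : f.IsHomogeneous a) :
    (Delta A f).IsHomogeneous (a - 2) := by
  rw [Delta_apply]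
  refine IsHomogeneous.sum _ _ _ fun i _ => IsHomogeneous.sum _ _ _ fun j _ => ?_
  rw [smul_eq_C_mul]
  exact (hf.pderiv.pderiv).C_mul _

theorem isHomogeneous_Delta_pow {f : MvPolynomial (Fin n) ℂ} {a : ℕ} (hf : f.IsHomogeneous a)
    (k : ℕ) : ((Delta A ^ k) f).IsHomogeneous (a - 2 * k) := by
  induction k with
  | zero => simpa using hf
  | succ k ih =>
    rw [pow_succ', Module.End.mul_apply]
    exact isHomogeneous_Delta A ih

theorem LD_comm (i j : Fin n) : Commute (LD A i) (LD A j) := by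
  refine Commute.sum_left _ _ _ fun a _ => Commute.sum_right _ _ _ fun b _ => ?_
  refine (Commute.smul_right ?_ _).smul_left _
  refine LinearMap.ext fun f => ?_
  exact pderiv_comm a b f

end Laplacian

theorem prod_ofFn_pow_add_single {M : Type*} [Monoid M] {n : ℕ} (x : Fin n → M)
    (hx : ∀ i j, Commute (x i) (x j)) (e : Fin n → ℕ) (i : Fin n) :
    (List.ofFn fun j => x j ^ (e j + if i = j then 1 else 0)).prod =
      (List.ofFn fun j => x j ^ e j).prod * x i := by
  induction n with
  | zero => exact i.elim0
  | succ n ih =>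
    simp only [List.ofFn_succ, List.prod_cons]
    refine Fin.cases ?_ (fun i => ?_) i
    · have hc : Commute (x 0) (List.ofFn fun j : Fin n => x j.succ ^ e j.succ).prod := by
        refine Commute.list_prod_right _ _ fun y hy => ?_
        obtain ⟨j, rfl⟩ := (List.mem_ofFn' _ _).1 hy
        exact (hx _ _).pow_right _
      have h0 (j : Fin n) : (0 : Fin (n + 1)) ≠ j.succ := (Fin.succ_ne_zero j).symm
      simp only [if_true, h0, if_false, add_zero]
      rw [pow_succ, mul_assoc, hc.eq, ← mul_assoc]
    · have h := ih (fun j => x j.succ) (fun _ _ => hx _ _) (fun j => e j.succ) i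
      simp only [Fin.succ_inj, Fin.succ_ne_zero, if_false, add_zero]
      rw [h, mul_assoc]

section Form

variable {n : ℕ} (A : Matrix (Fin n) (Fin n) ℂ)

theorem opOf_eq_sum_of_support_subset {f : MvPolynomial (Fin n) ℂ} {s : Finset (Fin n →₀ ℕ)}
    (hs : f.support ⊆ s) :
    opOf A f = ∑ e ∈ s, coeff e f • (List.ofFn fun i => LD A i ^ e i).prod :=
  sum_subset hs fun e _ he => by rw [notMem_support_iff.1 he, zero_smul]

theorem opOf_add (f g : MvPolynomial (Fin n) ℂ) : opOf A (f + g) = opOf A f + opOf A g := by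
  classical
  rw [opOf_eq_sum_of_support_subset A (support_add (p := f) (q := g)),
    opOf_eq_sum_of_support_subset A (subset_union_left (s₁ := f.support) (s₂ := g.support)),
    opOf_eq_sum_of_support_subset A (subset_union_right (s₁ := f.support) (s₂ := g.support)),
    ← sum_add_distrib]
  exact sum_congr rfl fun e _ => by rw [coeff_add, add_smul]

theorem opOf_monomial (e : Fin n →₀ ℕ) (c : ℂ) :
    opOf A (monomial e c) = c • (List.ofFn fun i => LD A i ^ e i).prod := by
  classical
  rw [opOf_eq_sum_of_support_subset A support_monomial_subset, sum_singleton, coeff_monomial,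
    if_pos rfl]

theorem opOf_C_mul (c : ℂ) (f : MvPolynomial (Fin n) ℂ) : opOf A (C c * f) = c • opOf A f := by
  induction f using MvPolynomial.induction_on' with
  | monomial e b => rw [C_mul_monomial, opOf_monomial, opOf_monomial, mul_smul]
  | add f g hf hg => rw [mul_add, opOf_add, opOf_add, hf, hg, smul_add]

theorem opOf_X_mul (i : Fin n) (f : MvPolynomial (Fin n) ℂ) :
    opOf A (X i * f) = opOf A f * LD A i := by
  induction f using MvPolynomial.induction_on' with
  | monomial e b =>
    have h : X i * monomial e b = monomial (e + Finsupp.single i 1) b := by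
      rw [X, monomial_mul, one_mul, add_comm]
    rw [h, opOf_monomial, opOf_monomial, smul_mul_assoc, ← prod_ofFn_pow_add_single _ (LD_comm A)]
    simp only [Finsupp.add_apply, Finsupp.single_apply]
  | add f g hf hg => rw [mul_add, opOf_add, opOf_add, hf, hg, add_mul]

/-- `f ↦ f(AD)` as a linear map. -/
noncomputable def opOfLinear :
    MvPolynomial (Fin n) ℂ →ₗ[ℂ] Module.End ℂ (MvPolynomial (Fin n) ℂ) where
  toFun := opOf A
  map_add' := opOf_add A
  map_smul' c f := by rw [smul_eq_C_mul, opOf_C_mul]; rfl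

theorem nsmul_opOf {f : MvPolynomial (Fin n) ℂ} {N : ℕ} (hf : f.IsHomogeneous N) :
    N • opOf A f = ∑ i, opOf A (pderiv i f) * LD A i := by
  have h := congrArg (opOfLinear A) hf.sum_X_mul_pderiv
  rw [map_sum, map_nsmul] at h
  rw [show opOf A f = opOfLinear A f from rfl, ← h]
  exact sum_congr rfl fun i _ => opOf_X_mul A i _

theorem natCast_mul_bform {f : MvPolynomial (Fin n) ℂ} {N : ℕ} (hf : f.IsHomogeneous N)
    (g : MvPolynomial (Fin n) ℂ) :
    (N : ℂ) * bform A f g = ∑ i, ∑ j, A i j * bform A (pderiv i f) (pderiv j g) := by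
  have h := congrArg (fun T : Module.End ℂ (MvPolynomial (Fin n) ℂ) => constantCoeff (T g))
    (nsmul_opOf A hf)
  simpa [LinearMap.sum_apply, LD_apply, bform] using h

variable {A} in
theorem constantCoeff_Delta_pow_mul (hA : A.IsSymm) {N : ℕ} {f g : MvPolynomial (Fin n) ℂ}
    (hf : Delta A f = 0) (hg : Delta A g = 0) (hfN : f.IsHomogeneous N) :
    constantCoeff ((Delta A ^ N) (f * g)) = 2 ^ N * N.factorial * bform A f g := by
  induction N generalizing f g with
  | zero =>
    rw [((totalDegree_zero_iff_isHomogeneous _).2 hfN |> totalDegree_eq_zero_iff_eq_C.1)]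
    rw [bform, C_apply, opOf_monomial]
    simp
  | succ N ih =>
    have hD (i : Fin n) {u : MvPolynomial (Fin n) ℂ} (hu : Delta A u = 0) :
        Delta A (pderiv i u) = 0 := by rw [← pderiv_Delta, hu, map_zero]
    have h := natCast_mul_bform A hfN g
    rw [Delta_pow_succ_mul_of_harmonic hA hf hg, Nat.factorial_succ]
    have e : (2 ^ (N + 1) * ((N + 1) * N.factorial : ℕ) * bform A f g : ℂ) =
        2 * (2 ^ N * N.factorial * (((N + 1 : ℕ) : ℂ) * bform A f g)) := by
      push_cast
      ring
    rw [e, h]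
    simp only [constantCoeff_smul, smul_eq_mul, map_sum, mul_sum]
    refine sum_congr rfl fun i _ => sum_congr rfl fun j _ => ?_
    rw [ih (hD i hf) (hD j hg) hfN.pderiv]
    ring

variable {A} in
theorem bform_Delta_pow_self (hA : A.IsSymm) {d : ℕ} (hd : 3 ≤ d) {P : MvPolynomial (Fin n) ℂ}
    (hP : P.IsHomogeneous d) (hnil : LNil (Delta A) P) (m : ℕ) :
    bform A ((Delta A ^ m) (P ^ (m + 1))) ((Delta A ^ m) (P ^ (m + 1))) = 0 := by
  have hharm (k : ℕ) : Delta A ((Delta A ^ k) (P ^ (k + 1))) = 0 := by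
    rw [← Module.End.mul_apply, ← pow_succ']
    exact hnil (k + 1) (by omega)
  have hhom (k : ℕ) : ((Delta A ^ k) (P ^ (k + 1))).IsHomogeneous (d * (k + 1) - 2 * k) :=
    isHomogeneous_Delta_pow A (hP.pow (k + 1)) k
  have hdeg (k : ℕ) : d * (k + 1) - 2 * k = d + (d - 2) * k := by
    obtain ⟨c, rfl⟩ : ∃ c, d = c + 3 := ⟨d - 3, by omega⟩
    have : c + 3 - 2 = c + 1 := rfl
    rw [this, Nat.sub_eq_iff_eq_add (by nlinarith)]
    ring
  simp only [hdeg] at hhom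
  set N := d + (d - 2) * m with hN
  have hlt {k : ℕ} (hk : k < m) : d + (d - 2) * k < N :=
    Nat.add_lt_add_left (Nat.mul_lt_mul_of_pos_left hk (by omega)) d
  have hz : (Delta A ^ N) (PowerSeries.coeff (2 * m) (inversionSeries A P ^ 2)) = 0 := by
    rw [show N = (N - 2) + 2 by omega, pow_add, Module.End.mul_apply,
      Delta_sq_coeff_inversionSeries_sq A hnil, map_zero]
  rw [pow_two, PowerSeries.coeff_mul, map_sum, sum_eq_single (m, m)] at hz
  · simp only [inversionSeries, PowerSeries.coeff_mk, smul_mul_smul_comm, map_smul] at hz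
    have hz' := (smul_eq_zero.1 hz).resolve_left
      (mul_ne_zero (inversionCoeff_ne_zero m) (inversionCoeff_ne_zero m))
    have h := constantCoeff_Delta_pow_mul hA (hharm m) (hharm m) (hhom m)
    rw [← hN, hz', map_zero] at h
    have hf : (N.factorial : ℂ) ≠ 0 := by exact_mod_cast N.factorial_ne_zero
    exact (mul_eq_zero.1 h.symm).resolve_left (by simp [hf])
  · rintro ⟨i, j⟩ hij hne
    rw [HasAntidiagonal.mem_antidiagonal] at hij
    simp only [inversionSeries, PowerSeries.coeff_mk, smul_mul_smul_comm, map_smul]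
    have hlt' : i < m ∨ j < m := by
      by_contra! hc
      exact hne (Prod.ext (by simp only at hij ⊢; omega) (by simp only at hij ⊢; omega))
    rcases hlt' with hi | hj
    · rw [Delta_pow_mul_eq_zero hA (hlt hi) (hharm i) (hharm j) (hhom i), smul_zero]
    · rw [mul_comm ((Delta A ^ i) _),
        Delta_pow_mul_eq_zero hA (hlt hj) (hharm j) (hharm i) (hhom j), smul_zero]
  · intro h
    exact absurd (HasAntidiagonal.mem_antidiagonal.2 (two_mul m).symm) h

end Form

/-- For a homogeneous `Δ_A`-nilpotent `P` of degree `d ≥ 3`, each `Δ_A^m P^{m+1}` is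
isotropic for `(·,·)_A`; in particular `(P, P)_A = 0`. -/
theorem stmt19 {n : ℕ} (A : Matrix (Fin n) (Fin n) ℂ) (hA : A.IsSymm) (hAu : IsUnit A)
    {d : ℕ} (hd : 3 ≤ d) (P : MvPolynomial (Fin n) ℂ) (hP : P.IsHomogeneous d)
    (hnil : LNil (Delta A) P) :
    (∀ m : ℕ,
      bform A (((Delta A) ^ m) (P ^ (m + 1))) (((Delta A) ^ m) (P ^ (m + 1))) = 0) ∧
    bform A P P = 0 := by
  exact ⟨bform_Delta_pow_self hA hd hP hnil, by simpa using bform_Delta_pow_self hA hd hP hnil 0⟩
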